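/- arXiv:1108.6205 — 4 statements merged into one kernel-verified Lean document; each statement's English description precedes it below -/
import Mathlib

section
/- Let A be an associative, not necessarily commutative, unital ℚ-algebra with a derivation d, let u ∈ A, and set K₂ := (1/4)d³u + (3/2)(u·(d u) + (d u)·u), P := (1/4)d²u + (3/2)u², and Q := (1/4)(u·(d u) − (d u)·u). Then (1/4)d²K₂ + (u·K₂ + K₂·u) + (1/2)((d u)·P + P·(d u)) + (u·Q − Q·u) = (1/16)d⁵u + (5/8)(u·d³u + (d³u)·u) + (5/4)((d²u)·(d u) + (d u)·(d²u)) + (5/2)(u²·(d u) + u·(d u)·u + (d u)·u²). That is, the recursion operator Φ(2), applied to the noncommutative KdV flow with the local antiderivative choices P and Q, produces the fifth-order noncommutative KdV flow. -/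
/-- The recursion operator Φ(2), applied to the noncommutative KdV flow
K₂ = (1/4)d³u + (3/2)(u·du + du·u) with the local antiderivative choices
P = (1/4)d²u + (3/2)u² and Q = (1/4)(u·du − du·u), produces the fifth-order
noncommutative KdV flow. -/
theorem ncKdV_recursion_gives_fifth_order
    (A : Type*) [Ring A] [Algebra ℚ A]
    (d : A →ₗ[ℚ] A) (hd : ∀ a b : A, d (a * b) = d a * b + a * d b)
    (u K₂ P Q : A)
    (hK₂ : K₂ = (1/4 : ℚ) • d (d (d u)) + (3/2 : ℚ) • (u * d u + d u * u))
    (hP : P = (1/4 : ℚ) • d (d u) + (3/2 : ℚ) • (u * u))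
    (hQ : Q = (1/4 : ℚ) • (u * d u - d u * u)) :
    (1/4 : ℚ) • d (d K₂) + (u * K₂ + K₂ * u)
      + (1/2 : ℚ) • (d u * P + P * d u) + (u * Q - Q * u)
    = (1/16 : ℚ) • d (d (d (d (d u))))
      + (5/8 : ℚ) • (u * d (d (d u)) + d (d (d u)) * u)
      + (5/4 : ℚ) • (d (d u) * d u + d u * d (d u))
      + (5/2 : ℚ) • (u * u * d u + u * d u * u + d u * (u * u)) := by
  subst hK₂ hP hQ
  simp only [map_add, map_smul, hd, mul_add, add_mul, mul_sub, sub_mul, smul_add, smul_sub,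
    mul_smul_comm, smul_mul_assoc, smul_smul, mul_assoc]
  module
end

section
/- Let A be an associative, not necessarily commutative, unital ℚ-algebra and let X, Y, T : A → A be pairwise commuting derivations. Let u, u₂, u₃, u₄ ∈ A satisfy X u = u₂, Y u = 2u₃ + X u₂, T u = 3u₄ + 3X u₃ + X²u₂ + 3u₂², together with the noncommutative KP flow equations Y u₂ = 2X u₃ + X²u₂ and Y u₃ = 2X u₄ + X²u₃ + 2u₂·(X u₂) + 2(u₂u₃ − u₃u₂). Then u satisfies the noncommutative KP equation: 3·Y(Y u) − 6·[X u, Y u] = X(4·T u − X³u − 6·(X u)²). -/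
/-- From the t₂- and t₃-flow equations of the noncommutative KP hierarchy together
with the potential substitution X u = u₂, the potential u satisfies the
noncommutative KP equation 3u_yy − 6[u_x, u_y] = (4u_t − u_xxx − 6u_x²)_x. -/
theorem ncKP_equation_from_flows
    (A : Type*) [Ring A] [Algebra ℚ A]
    (X Y T : A →ₗ[ℚ] A)
    (hX : ∀ a b : A, X (a * b) = X a * b + a * X b)
    (hY : ∀ a b : A, Y (a * b) = Y a * b + a * Y b)
    (hT : ∀ a b : A, T (a * b) = T a * b + a * T b)
    (hXY : ∀ a : A, X (Y a) = Y (X a))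
    (hXT : ∀ a : A, X (T a) = T (X a))
    (hYT : ∀ a : A, Y (T a) = T (Y a))
    (u u₂ u₃ u₄ : A)
    (hu : X u = u₂)
    (hYu : Y u = (2 : ℚ) • u₃ + X u₂)
    (hTu : T u = (3 : ℚ) • u₄ + (3 : ℚ) • X u₃ + X (X u₂) + (3 : ℚ) • (u₂ * u₂))
    (hflow2 : Y u₂ = (2 : ℚ) • X u₃ + X (X u₂))
    (hflow3 : Y u₃ = (2 : ℚ) • X u₄ + X (X u₃) + (2 : ℚ) • (u₂ * X u₂)
        + (2 : ℚ) • (u₂ * u₃ - u₃ * u₂)) :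
    (3 : ℚ) • Y (Y u) - (6 : ℚ) • (X u * Y u - Y u * X u)
      = X ((4 : ℚ) • T u - X (X (X u)) - (6 : ℚ) • (X u * X u)) := by
  have hYX : Y (X u₂) = (2 : ℚ) • X (X u₃) + X (X (X u₂)) := by
    rw [← hXY, hflow2, map_add, map_smul]
  simp only [hTu, hu, hYu, map_add, map_sub, map_smul, hflow3, hYX, hX, mul_add, add_mul,
    mul_smul_comm, smul_mul_assoc]
  module
end

section
/- Let A be an associative, not necessarily commutative, unital ℚ-algebra with a derivation d, let u ∈ A, and define the 2-reduction substitutions u₃ := −(1/2)d u, u₄ := (1/4)d²u − (1/2)u², u₅ := −(1/8)d³u + u·(d u) + (1/2)(d u)·u, and u₆ := (1/16)d⁴u − (11/8)(d u)² − (11/8)u·(d²u) − (3/8)(d²u)·u + (1/2)u³. Then 5·d u₆ + 10·d²u₅ + 10·d³u₄ + 5·d⁴u₃ + d⁵u + 10(d²u)·u₃ + 10u·(d u)·u + 10u·(d³u) + 5[d³u, u] + 20(d u)·(d²u) + 10[d²u, d u] + 20(d²u₃)·u + 10[u, d²u₃] + 30(d u₃)·(d u) + 20[d u, d u₃] + 20(d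 u)·u² + 10[u², d u] + 20u₃·(d u₃) + 10[d u₃, u₃] + 20u₄·(d u) + 10[d u, u₄] + 20(d u₄)·u + 10[u, d u₄] = (1/16)d⁵u + (5/8)(u·(d³u) + (d³u)·u) + (5/4)((d²u)·(d u) + (d u)·(d²u)) + (5/2)(u²·(d u) + u·(d u)·u + (d u)·u²). That is, substituting the 2-reduction expressions for u₃, u₄, u₅, u₆ into the t₅-flow of u₂ of the noncommutative KP hierarchy yields the fifth-order noncommutative KdV flow. -/
/-- Substituting the 2-reduction expressions for u₃, u₄, u₅, u₆ into the t₅-flow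
of u₂ of the noncommutative KP hierarchy yields the fifth-order noncommutative
KdV flow. -/
theorem ncKP_two_reduction_t5_flow
    (A : Type*) [Ring A] [Algebra ℚ A]
    (d : A →ₗ[ℚ] A) (hd : ∀ a b : A, d (a * b) = d a * b + a * d b)
    (u u₃ u₄ u₅ u₆ : A)
    (hu₃ : u₃ = -((1/2 : ℚ) • d u))
    (hu₄ : u₄ = (1/4 : ℚ) • d (d u) - (1/2 : ℚ) • (u * u))
    (hu₅ : u₅ = -((1/8 : ℚ) • d (d (d u))) + u * d u + (1/2 : ℚ) • (d u * u))
    (hu₆ : u₆ = (1/16 : ℚ) • d (d (d (d u))) - (11/8 : ℚ) • (d u * d u)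
        - (11/8 : ℚ) • (u * d (d u)) - (3/8 : ℚ) • (d (d u) * u)
        + (1/2 : ℚ) • (u * u * u)) :
    (5 : ℚ) • d u₆ + (10 : ℚ) • d (d u₅) + (10 : ℚ) • d (d (d u₄))
      + (5 : ℚ) • d (d (d (d u₃))) + d (d (d (d (d u))))
      + (10 : ℚ) • (d (d u) * u₃)
      + (10 : ℚ) • (u * d u * u)
      + (10 : ℚ) • (u * d (d (d u)))
      + (5 : ℚ) • (d (d (d u)) * u - u * d (d (d u)))
      + (20 : ℚ) • (d u * d (d u))
      + (10 : ℚ) • (d (d u) * d u - d u * d (d u))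
      + (20 : ℚ) • (d (d u₃) * u)
      + (10 : ℚ) • (u * d (d u₃) - d (d u₃) * u)
      + (30 : ℚ) • (d u₃ * d u)
      + (20 : ℚ) • (d u * d u₃ - d u₃ * d u)
      + (20 : ℚ) • (d u * (u * u))
      + (10 : ℚ) • (u * u * d u - d u * (u * u))
      + (20 : ℚ) • (u₃ * d u₃)
      + (10 : ℚ) • (d u₃ * u₃ - u₃ * d u₃)
      + (20 : ℚ) • (u₄ * d u)
      + (10 : ℚ) • (d u * u₄ - u₄ * d u)
      + (20 : ℚ) • (d u₄ * u)
      + (10 : ℚ) • (u * d u₄ - d u₄ * u)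
    = (1/16 : ℚ) • d (d (d (d (d u))))
      + (5/8 : ℚ) • (u * d (d (d u)) + d (d (d u)) * u)
      + (5/4 : ℚ) • (d (d u) * d u + d u * d (d u))
      + (5/2 : ℚ) • (u * u * d u + u * d u * u + d u * (u * u)) := by
  subst hu₃ hu₄ hu₅ hu₆
  simp only [map_add, map_sub, map_neg, map_smul, hd, mul_add, add_mul, mul_sub, sub_mul,
    mul_neg, neg_mul, smul_mul_assoc, mul_smul_comm, mul_assoc]
  module
end

section
/- Let A be an associative, not necessarily commutative, unital ℚ-algebra with a derivation d, let u₂, u₃, u₄, u₅, u₆ ∈ A, and set p₃ := 5u₂, p₂ := 5u₃ + 10·d u₂, p₁ := 5u₄ + 10·d u₃ + 10·d²u₂ + 10u₂², p₀ := 5u₅ + 10·d u₄ + 10·d²u₃ + 5·d³u₂ + 20u₂u₃ + 10[u₃, u₂] + 20u₂·(d u₂) + 10[d u₂, u₂] (the coefficients of ∂³, ∂², ∂¹, ∂⁰ in L⁵₊). Then the general flow formula of the noncommutative KP hierarchy specialized to m = 5, h = 1 simplifies as follows: 5·d u₆ + 10·d²u₅ + 10·d³u₄ + 5·d⁴u₃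 + d⁵u₂ + 3p₃·(d u₄) + 3p₃·(d²u₃) + p₃·(d³u₂) + 2p₂·(d u₃) + p₂·(d²u₂) + p₁·(d u₂) + u₂·(d³p₃) − 3u₃·(d²p₃) + 3u₄·(d p₃) − u₂·(d²p₂) + 2u₃·(d p₂) + u₂·(d p₁) + [p₃, u₅] + [p₂, u₄] + [p₁, u₃] + [p₀, u₂] = 5·d u₆ + 10·d²u₅ + 10·d³u₄ + 5·d⁴u₃ + d⁵u₂ + 10(d²u₂)·u₃ + 10u₂·(d u₂)·u₂ + 10u₂·(d³u₂) + 5[d³u₂, u₂] + 20(d u₂)·(d²u₂) + 10[d²u₂, d u₂] + 20(d²u₃)·u₂ + 10[u₂, d²u₃] + 30(d u₃)·(d u₂) + 20[d u₂, d u₃] + 20(d u₂)·u₂² + 10[u₂², d u₂] + 20u₃·(d u₃) + 10[d u₃, u₃] + 20u₄·(d u₂) + 10[d u₂, u₄] + 20(d u₄)·u₂ + 10[u₂, d u₄]. This is the t₅-flow equation for u₂ of the noncommutative KP hierarchy. -/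
/-- The general flow formula of the noncommutative KP hierarchy specialized to
m = 5, h = 1, with p₃, p₂, p₁, p₀ the coefficients of ∂³, ∂², ∂¹, ∂⁰ in L⁵₊,
simplifies to the t₅-flow equation for u₂ of the noncommutative KP hierarchy. -/
theorem ncKP_t5_flow_formula
    (A : Type*) [Ring A] [Algebra ℚ A]
    (d : A →ₗ[ℚ] A) (hd : ∀ a b : A, d (a * b) = d a * b + a * d b)
    (u₂ u₃ u₄ u₅ u₆ : A)
    (p₃ p₂ p₁ p₀ : A)
    (hp₃ : p₃ = (5 : ℚ) • u₂)
    (hp₂ : p₂ = (5 : ℚ) • u₃ + (10 : ℚ) • d u₂)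
    (hp₁ : p₁ = (5 : ℚ) • u₄ + (10 : ℚ) • d u₃ + (10 : ℚ) • d (d u₂)
        + (10 : ℚ) • (u₂ * u₂))
    (hp₀ : p₀ = (5 : ℚ) • u₅ + (10 : ℚ) • d u₄ + (10 : ℚ) • d (d u₃)
        + (5 : ℚ) • d (d (d u₂)) + (20 : ℚ) • (u₂ * u₃)
        + (10 : ℚ) • (u₃ * u₂ - u₂ * u₃) + (20 : ℚ) • (u₂ * d u₂)
        + (10 : ℚ) • (d u₂ * u₂ - u₂ * d u₂)) :
    (5 : ℚ) • d u₆ + (10 : ℚ) • d (d u₅) + (10 : ℚ) • d (d (d u₄))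
      + (5 : ℚ) • d (d (d (d u₃))) + d (d (d (d (d u₂))))
      + (3 : ℚ) • (p₃ * d u₄) + (3 : ℚ) • (p₃ * d (d u₃)) + p₃ * d (d (d u₂))
      + (2 : ℚ) • (p₂ * d u₃) + p₂ * d (d u₂) + p₁ * d u₂
      + u₂ * d (d (d p₃)) - (3 : ℚ) • (u₃ * d (d p₃)) + (3 : ℚ) • (u₄ * d p₃)
      - u₂ * d (d p₂) + (2 : ℚ) • (u₃ * d p₂) + u₂ * d p₁
      + (p₃ * u₅ - u₅ * p₃) + (p₂ * u₄ - u₄ * p₂) + (p₁ * u₃ - u₃ * p₁)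
      + (p₀ * u₂ - u₂ * p₀)
    = (5 : ℚ) • d u₆ + (10 : ℚ) • d (d u₅) + (10 : ℚ) • d (d (d u₄))
      + (5 : ℚ) • d (d (d (d u₃))) + d (d (d (d (d u₂))))
      + (10 : ℚ) • (d (d u₂) * u₃)
      + (10 : ℚ) • (u₂ * d u₂ * u₂)
      + (10 : ℚ) • (u₂ * d (d (d u₂)))
      + (5 : ℚ) • (d (d (d u₂)) * u₂ - u₂ * d (d (d u₂)))
      + (20 : ℚ) • (d u₂ * d (d u₂))
      + (10 : ℚ) • (d (d u₂) * d u₂ - d u₂ * d (d u₂))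
      + (20 : ℚ) • (d (d u₃) * u₂)
      + (10 : ℚ) • (u₂ * d (d u₃) - d (d u₃) * u₂)
      + (30 : ℚ) • (d u₃ * d u₂)
      + (20 : ℚ) • (d u₂ * d u₃ - d u₃ * d u₂)
      + (20 : ℚ) • (d u₂ * (u₂ * u₂))
      + (10 : ℚ) • (u₂ * u₂ * d u₂ - d u₂ * (u₂ * u₂))
      + (20 : ℚ) • (u₃ * d u₃)
      + (10 : ℚ) • (d u₃ * u₃ - u₃ * d u₃)
      + (20 : ℚ) • (u₄ * d u₂)
      + (10 : ℚ) • (d u₂ * u₄ - u₄ * d u₂)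
      + (20 : ℚ) • (d u₄ * u₂)
      + (10 : ℚ) • (u₂ * d u₄ - d u₄ * u₂) := by
  subst hp₃ hp₂ hp₁ hp₀
  simp only [map_add, map_smul, hd, smul_mul_assoc, mul_smul_comm, mul_add, add_mul, mul_sub,
    sub_mul, mul_assoc]
  module
end
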